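/- Shuffling Theorem for doubly-dented hexagons (Theorem 1.2 of the paper, from prior work of the author and Rohatgi): Let x,y,u,d,u',d',n be nonnegative integers with u,d,u',d' ≤ n, and let U={s_1<...<s_u}, D={t_1<...<t_d}, U'={s'_1<...<s'_{u'}}, D'={t'_1<...<t'_{d'}} be subsets of [x+y+n] such that U∪D = U'∪D' and U∩D = U'∩D' (so |U∪D|=n). Let B ⊆ [x+y+n]\(U∪D) with |B| ≤ x. Then M(H_{x,y}(U;D;B)) / M(H_{x,y}(U';D';B)) = [∏_{1≤i<j≤u} (s_j−s_i)/(j−i) · ∏_{1≤i<j≤d} (t_j−t_i)/(j−i) · PP(u,d,y)] / [∏_{1≤i<j≤u'} (s'_j−s'_i)/(j−i) · ∏_{1≤i<j≤d'} (t'_j−t'_i)/(j−i) · PP(u',d',y)]. -/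

import Mathlib

open Finset

/-- A unit triangle of the triangular lattice, in sheared coordinates:
`(true, a, j)` is the up-pointing triangle with horizontal base
`[a + j/2, a + 1 + j/2]` on the lattice line at height `j`;
`(false, a, j)` is the down-pointing triangle with apex `(a + 1 + j/2, j)`
and top edge on the lattice line at height `j + 1`. -/
abbrev Tri : Type := Bool × ℤ × ℤ

def upT (a j : ℤ) : Tri := (true, a, j)
def dnT (a j : ℤ) : Tri := (false, a, j)

/-- A lozenge (union of two unit triangles sharing an edge), recorded by the
coordinates of its up-pointing triangle (first component) and of its
down-pointing triangle (second component). -/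
abbrev Loz : Type := (ℤ × ℤ) × (ℤ × ℤ)

/-- The two triangles of a lozenge share an edge: the down-pointing triangle is
the right, left or lower neighbour of the up-pointing one. -/
def lozAdj (l : Loz) : Prop :=
  l.2 = l.1 ∨ l.2 = (l.1.1 - 1, l.1.2) ∨ l.2 = (l.1.1, l.1.2 - 1)

/-- `T` is a lozenge tiling of the region `R`: it consists of lozenges lying in
`R` and covers every unit triangle of `R` exactly once. -/
def IsTiling (R : Finset Tri) (T : Finset Loz) : Prop :=
  (∀ l ∈ T, lozAdj l ∧ upT l.1.1 l.1.2 ∈ R ∧ dnT l.2.1 l.2.2 ∈ R) ∧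
  (∀ t ∈ R, ∃! l, l ∈ T ∧ (t = upT l.1.1 l.1.2 ∨ t = dnT l.2.1 l.2.2))

/-- All lozenge tilings of `R` avoiding the forbidden lozenges in `F`
(the barriers), collected in a finset. -/
noncomputable def tilings (R : Finset Tri) (F : Finset Loz) : Finset (Finset Loz) := by
  classical
  exact ((R.image Prod.snd ×ˢ R.image Prod.snd).powerset).filter
    (fun T => IsTiling R T ∧ ∀ l ∈ T, l ∉ F)

/-- `Mtil R F` : the number of lozenge tilings of `R` avoiding the barriers `F`. -/
noncomputable def Mtil (R : Finset Tri) (F : Finset Loz) : ℕ := (tilings R F).card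

/-- Weighted tiling number: each lozenge in `Wt` carries weight `1/2`, all other
lozenges weight `1`; a tiling is weighted by the product of its lozenge weights. -/
noncomputable def Mw (R : Finset Tri) (F : Finset Loz) (Wt : Finset Loz) : ℚ :=
  ∑ T ∈ tilings R F, (1 / 2 : ℚ) ^ (T ∩ Wt).card

/-- Reflection of a unit triangle over the horizontal lattice line `l` (height `0`). -/
def reflTri (t : Tri) : Tri :=
  if t.1 then (false, t.2.1 + t.2.2, -t.2.2 - 1) else (true, t.2.1 + t.2.2 + 1, -t.2.2 - 1)

/-- Reflection of a lozenge over the horizontal lattice line `l` (height `0`). -/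
def reflLoz (l : Loz) : Loz :=
  ((l.2.1 + l.2.2 + 1, -l.2.2 - 1), (l.1.1 + l.1.2, -l.1.2 - 1))

/-- The up-pointing unit triangles removed at the positions of `U`
(1-indexed, from left to right) just above the line `l`. -/
def upDents (U : Finset ℕ) : Finset Tri := U.image (fun (i : ℕ) => upT ((i : ℤ) - 1) 0)

/-- The down-pointing unit triangles removed at the positions of `D`
(1-indexed, from left to right) just below the line `l`. -/
def dnDents (D : Finset ℕ) : Finset Tri := D.image (fun (i : ℕ) => dnT ((i : ℤ) - 1) (-1))

/-- The vertical lozenges straddling the line `l` at the barrier positions `B`: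
these are forbidden in any tiling. -/
def barrierLoz (B : Finset ℕ) : Finset Loz :=
  B.image (fun (i : ℕ) => (((i : ℤ) - 1, 0), ((i : ℤ) - 1, -1)))

/-- The upper half of a hexagon: the semihexagon (trapezoid) with base `W` on the
line `l` and `h` rows of unit triangles above it. -/
def upperHex (W h : ℕ) : Finset Tri :=
  (Finset.range h).biUnion fun j =>
    ((Finset.range (W - j)).image fun (a : ℕ) => upT (a : ℤ) (j : ℤ)) ∪
    ((Finset.range (W - j - 1)).image fun (a : ℕ) => dnT (a : ℤ) (j : ℤ))

/-- The doubly-dented hexagon `H_{x,y}(U; D)` (with `n = |U ∪ D|` recorded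
explicitly): the hexagon of side lengths `x+n-u, y+u, y+d, x+n-d, y+d, y+u`
(clockwise from the north side) with the up-pointing unit triangles at the
positions of `U` and the down-pointing unit triangles at the positions of `D`
removed along the horizontal axis `l` through its west and east vertices. -/
def Hreg (x y n : ℕ) (U D : Finset ℕ) : Finset Tri :=
  (upperHex (x + y + n) (y + U.card) \ upDents U) ∪
  ((upperHex (x + y + n) (y + D.card)).image reflTri \ dnDents D)

/-- The quartered hexagon `L_{m,n}(A)`: the trapezoid whose northern,
northeastern, southern sides have lengths `n`, `m`, `n + ⌊(m+1)/2⌋` and whose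
western side is a vertical zigzag of `m` steps, with the up-pointing unit
triangles at the positions of `A` removed from the base. -/
def Lreg (m n : ℕ) (A : Finset ℕ) : Finset Tri :=
  ((Finset.range m).biUnion fun j =>
    ((Finset.range (n + (m + 1) / 2 + j / 2 - j)).image
        fun (a : ℕ) => upT ((a : ℤ) - ((j / 2 : ℕ) : ℤ)) (j : ℤ)) ∪
    ((Finset.range (n + (m + 1) / 2 + (j + 1) / 2 - (j + 1))).image
        fun (a : ℕ) => dnT ((a : ℤ) - (((j + 1) / 2 : ℕ) : ℤ)) (j : ℤ)))
  \ upDents A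

/-- The vertical lozenges sitting along (the bumps of) the western zigzag side
of the quartered hexagon `L_{m,n}`; these get weight `1/2` in `L̄_{m,n}`. -/
def westLoz (m : ℕ) : Finset Loz :=
  ((Finset.range m).filter fun j => j % 2 = 1).image fun j =>
    ((-(((j - 1) / 2 : ℕ) : ℤ), (j : ℤ)), (-(((j - 1) / 2 : ℕ) : ℤ), (j : ℤ) - 1))

/-- The doubly-dented halved hexagon `F_{x,y}(U; D)`: north, northeast,
southeast, south sides of lengths `x+n-u, 2y+2u, 2y+2d, x+n-d`, western side a
vertical zigzag with `4y+2u+2d` steps, with up-dents `U` and down-dents `D`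
along the horizontal line `l` through the east vertex. -/
def Freg (x y n : ℕ) (U D : Finset ℕ) : Finset Tri :=
  Lreg (2 * y + 2 * U.card) (x + n - U.card) U ∪
  (Lreg (2 * y + 2 * D.card) (x + n - D.card) D).image reflTri

/-- The doubly-dented halved hexagon `F̄_{x,y}(U; D)`: side lengths
`x+n-u, 2y-1+2u, 2y-1+2d, x+n-d` and a western zigzag with `4y+2u+2d-2` steps,
with up-dents `U` and down-dents `D` along the line `l` through the east vertex. -/
def Fbar (x y n : ℕ) (U D : Finset ℕ) : Finset Tri :=
  Lreg (2 * y + 2 * U.card - 1) (x + n - U.card) U ∪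
  (Lreg (2 * y + 2 * D.card - 1) (x + n - D.card) D).image reflTri

/-- The weight-`1/2` vertical lozenges on the western side of `W_{x,y}(U;D;B)`
(where `u = |U|`, `d = |D|`). -/
def wtW (y u d : ℕ) : Finset Loz :=
  westLoz (2 * y + 2 * u) ∪ (westLoz (2 * y + 2 * d)).image reflLoz

/-- The weight-`1/2` vertical lozenges on the western side of `W̄_{x,y}(U;D;B)`. -/
def wtWbar (y u d : ℕ) : Finset Loz :=
  westLoz (2 * y + 2 * u - 1) ∪ (westLoz (2 * y + 2 * d - 1)).image reflLoz

/-- `m - S = {m - s : s ∈ S}`. -/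
def mirrorSet (m : ℕ) (S : Finset ℕ) : Finset ℕ := S.image fun i => m - i

/-- The reflectively symmetric doubly-dented hexagon
`RS_{x,y}(U;D) = H_{x,y}(U ∪ ((x+y+2n+1)-U); D ∪ ((x+y+2n+1)-D))`. -/
def RSreg (x y n : ℕ) (U D : Finset ℕ) : Finset Tri :=
  Hreg x y (2 * n) (U ∪ mirrorSet (x + y + 2 * n + 1) U)
    (D ∪ mirrorSet (x + y + 2 * n + 1) D)

/-- Reflection of a lozenge over the vertical symmetry axis of a region whose
base on the line `l` spans the horizontal interval `[0, W]`. -/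
def vreflLoz (W : ℤ) (l : Loz) : Loz :=
  ((W - 1 - l.1.1 - l.1.2, l.1.2), (W - 2 - l.2.1 - l.2.2, l.2.2))

/-- The number of lozenge tilings of `R` (avoiding the barriers `F`) invariant
under the reflection over the vertical axis of a base of width `W`. -/
noncomputable def Msym (R : Finset Tri) (F : Finset Loz) (W : ℤ) : ℕ := by
  classical
  exact ((tilings R F).filter fun T => T.image (vreflLoz W) = T).card

/-- `M_r(RS_{x,y}(U;D;B))` : the number of reflectively symmetric lozenge
tilings of the symmetric doubly-dented hexagon with barriers at
`B ∪ ((x+y+2n+1)-B)`. -/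
noncomputable def Mr (x y n : ℕ) (U D B : Finset ℕ) : ℕ :=
  Msym (RSreg x y n U D)
    (barrierLoz (B ∪ mirrorSet (x + y + 2 * n + 1) B))
    ((x : ℤ) + (y : ℤ) + 2 * (n : ℤ))

/-- The skipping hyperfactorial: `H2 (2k) = 0! 2! ⋯ (2k-2)!` and
`H2 (2k+1) = 1! 3! ⋯ (2k-1)!`. -/
def H2 (n : ℕ) : ℕ :=
  ∏ j ∈ (Finset.range n).filter (fun j => j % 2 = n % 2), Nat.factorial j

/-- `∏_{1 ≤ i < j ≤ k} (s_j² - s_i²)` for the increasing enumeration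
`s_1 < ⋯ < s_k` of `S`. -/
def prodDiffSq (S : Finset ℕ) : ℚ :=
  ∏ p ∈ S, ∏ q ∈ S.filter (fun q => p < q), ((q : ℚ) ^ 2 - (p : ℚ) ^ 2)

/-- `∏_{1 ≤ i < j ≤ k} (s_j - s_i)`. -/
def prodDiff (S : Finset ℕ) : ℚ :=
  ∏ p ∈ S, ∏ q ∈ S.filter (fun q => p < q), ((q : ℚ) - (p : ℚ))

/-- `∏_{1 ≤ i < j ≤ k} (s_j - s_i)(s_j + s_i - 1)`. -/
def prodDS1 (S : Finset ℕ) : ℚ :=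
  ∏ p ∈ S, ∏ q ∈ S.filter (fun q => p < q), (((q : ℚ) - (p : ℚ)) * ((q : ℚ) + (p : ℚ) - 1))

/-- `∏_{1 ≤ i < j ≤ k} (s_j - s_i)(s_j + s_i - 2)`. -/
def prodDS2 (S : Finset ℕ) : ℚ :=
  ∏ p ∈ S, ∏ q ∈ S.filter (fun q => p < q), (((q : ℚ) - (p : ℚ)) * ((q : ℚ) + (p : ℚ) - 2))

/-- `∏_{1 ≤ i < j ≤ k} (s_i + s_j)`. -/
def prodSum0 (S : Finset ℕ) : ℚ :=
  ∏ p ∈ S, ∏ q ∈ S.filter (fun q => p < q), ((q : ℚ) + (p : ℚ))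

/-- `∏_{1 ≤ i < j ≤ k} (s_i + s_j - 1)`. -/
def prodSum1 (S : Finset ℕ) : ℚ :=
  ∏ p ∈ S, ∏ q ∈ S.filter (fun q => p < q), ((q : ℚ) + (p : ℚ) - 1)

/-- `∏_{1 ≤ i < j ≤ k} (s_i + s_j - 2)`. -/
def prodSum2 (S : Finset ℕ) : ℚ :=
  ∏ p ∈ S, ∏ q ∈ S.filter (fun q => p < q), ((q : ℚ) + (p : ℚ) - 2)

/-- `∏_{1 ≤ i ≤ j ≤ k} (s_i + s_j - 1)` (the diagonal `i = j` included). -/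
def prodSumLe1 (S : Finset ℕ) : ℚ :=
  ∏ p ∈ S, ∏ q ∈ S.filter (fun q => p ≤ q), ((q : ℚ) + (p : ℚ) - 1)


/-- `∏_{1 ≤ i < j ≤ u} (j - i) = 0! 1! ⋯ (u-1)!`, the denominator of the
Cohn--Larsen--Propp product. -/
def sfQ (u : ℕ) : ℚ := ∏ j ∈ Finset.range u, (Nat.factorial j : ℚ)

/-- MacMahon's box formula `PP(a,b,c) = ∏∏∏ (i+j+k-1)/(i+j+k-2)`. -/
def PP (a b c : ℕ) : ℚ :=
  ∏ i ∈ Finset.range a, ∏ j ∈ Finset.range b, ∏ k ∈ Finset.range c,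
    ((i : ℚ) + (j : ℚ) + (k : ℚ) + 2) / ((i : ℚ) + (j : ℚ) + (k : ℚ) + 1)

/-- The lozenge `l` covers the unit triangle `t`. -/
def Covers (l : Loz) (t : Tri) : Prop := t = upT l.1.1 l.1.2 ∨ t = dnT l.2.1 l.2.2

theorem isTiling_iff {R : Finset Tri} {T : Finset Loz} :
    IsTiling R T ↔ (∀ l ∈ T, lozAdj l ∧ ∀ t, Covers l t → t ∈ R) ∧
      ∀ t ∈ R, ∃! l, l ∈ T ∧ Covers l t := by
  unfold IsTiling Covers
  refine and_congr (forall₂_congr fun l _ => and_congr_right fun _ => ?_) Iff.rfl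
  constructor
  · rintro ⟨h1, h2⟩ t (rfl | rfl) <;> assumption
  · exact fun h => ⟨h _ (Or.inl rfl), h _ (Or.inr rfl)⟩

theorem mem_tilings {R : Finset Tri} {F T : Finset Loz} :
    T ∈ tilings R F ↔ IsTiling R T ∧ ∀ l ∈ T, l ∉ F := by
  classical
  unfold tilings
  rw [mem_filter, and_iff_right_iff_imp, mem_powerset]
  rintro ⟨⟨h, -⟩, -⟩ l hl
  obtain ⟨-, h1, h2⟩ := h l hl
  exact mem_product.2 ⟨mem_image_of_mem Prod.snd h1, mem_image_of_mem Prod.snd h2⟩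

theorem Mtil_image (φ : Tri ≃ Tri) (ψ : Loz ≃ Loz) (hadj : ∀ l, lozAdj (ψ l) ↔ lozAdj l)
    (hcov : ∀ l t, Covers (ψ l) (φ t) ↔ Covers l t) (R : Finset Tri) :
    Mtil (R.image φ) ∅ = Mtil R ∅ := by
  have key : ∀ T : Finset Loz, IsTiling (R.image φ) (T.image ψ) ↔ IsTiling R T := by
    intro T
    rw [isTiling_iff, isTiling_iff]
    simp only [forall_mem_image, hadj]
    refine and_congr (forall₂_congr fun l _ => and_congr_right fun _ => ?_)
      (forall₂_congr fun t _ => ?_)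
    · rw [← φ.forall_congr_right]
      simp [hcov]
    · rw [← ψ.existsUnique_congr_right]
      simp [hcov]
  symm
  refine card_bij (fun T _ => T.image ψ) ?_ ?_ ?_
  · intro T hT
    simp only [mem_tilings, notMem_empty, not_false_eq_true, implies_true, and_true] at hT ⊢
    exact (key T).2 hT
  · intro T _ T' _ h
    exact image_injective ψ.injective h
  · intro T hT
    have : (T.image ψ.symm).image ψ = T := by simp [image_image]
    refine ⟨T.image ψ.symm, ?_, this⟩
    simp only [mem_tilings, notMem_empty, not_false_eq_true, implies_true, and_true] at hT ⊢
    rw [← key, this]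
    exact hT

/-- The upward shift of unit triangles by one row. -/
def shiftTri : Tri ≃ Tri where
  toFun t := (t.1, t.2.1, t.2.2 + 1)
  invFun t := (t.1, t.2.1, t.2.2 - 1)
  left_inv t := by simp
  right_inv t := by simp

/-- The upward shift of lozenges by one row. -/
def shiftLoz : Loz ≃ Loz where
  toFun l := ((l.1.1, l.1.2 + 1), (l.2.1, l.2.2 + 1))
  invFun l := ((l.1.1, l.1.2 - 1), (l.2.1, l.2.2 - 1))
  left_inv l := by simp
  right_inv l := by simp

theorem Mtil_image_shiftTri (R : Finset Tri) : Mtil (R.image shiftTri) ∅ = Mtil R ∅ := by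
  refine Mtil_image shiftTri shiftLoz ?_ ?_ R
  · rintro ⟨⟨a, b⟩, c, d⟩
    simp only [lozAdj, shiftLoz, Equiv.coe_fn_mk, Prod.mk.injEq]
    omega
  · rintro ⟨⟨a, b⟩, c, d⟩ ⟨e, f, g⟩
    simp [Covers, shiftTri, shiftLoz, upT, dnT]

theorem reflTri_involutive : Function.Involutive reflTri := by
  rintro ⟨b, a, j⟩
  cases b <;> simp [reflTri]
  ring

theorem reflLoz_involutive : Function.Involutive reflLoz := by
  rintro ⟨⟨a, b⟩, c, d⟩
  simp [reflLoz]
  ring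

theorem Mtil_image_reflTri (R : Finset Tri) : Mtil (R.image reflTri) ∅ = Mtil R ∅ := by
  refine Mtil_image reflTri_involutive.toPerm reflLoz_involutive.toPerm ?_ ?_ R
  · rintro ⟨⟨a, b⟩, c, d⟩
    simp only [lozAdj, reflLoz, Function.Involutive.coe_toPerm, Prod.mk.injEq]
    omega
  · rintro ⟨⟨a, b⟩, c, d⟩ ⟨e, f, g⟩
    cases e <;>
      simp only [Covers, reflTri, reflLoz, upT, dnT, Function.Involutive.coe_toPerm, Prod.mk.injEq,
        if_true, if_false, Bool.false_eq_true, reduceCtorEq, true_and, false_and, false_or,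
        or_false] <;> omega

/-- The vertical lozenge straddling the line at height `0` at position `i`. -/
def vertLoz (i : ℕ) : Loz := (((i : ℤ) - 1, 0), ((i : ℤ) - 1, -1))

theorem vertLoz_injective : Function.Injective vertLoz := by
  intro i j h
  simpa [vertLoz] using h

theorem barrierLoz_eq (B : Finset ℕ) : barrierLoz B = B.image vertLoz := rfl

theorem mem_upDents {U : Finset ℕ} {t : Tri} :
    t ∈ upDents U ↔ ∃ i ∈ U, Covers (vertLoz i) t ∧ t.1 = true := by
  unfold upDents Covers vertLoz upT dnT
  rw [mem_image]
  grind

theorem mem_dnDents {U : Finset ℕ} {t : Tri} :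
    t ∈ dnDents U ↔ ∃ i ∈ U, Covers (vertLoz i) t ∧ t.1 = false := by
  unfold dnDents Covers vertLoz upT dnT
  rw [mem_image]
  grind

section Cut

variable {R₁ R₂ : Finset Tri} {C S : Finset ℕ}

theorem Covers.height {l : Loz} {t : Tri} (h : Covers l t) :
    t.2.2 = l.1.2 ∨ t.2.2 = l.2.2 := by
  rcases h with rfl | rfl
  · exact Or.inl rfl
  · exact Or.inr rfl

theorem covers_fst (l : Loz) : Covers l (upT l.1.1 l.1.2) := Or.inl rfl

theorem covers_snd (l : Loz) : Covers l (dnT l.2.1 l.2.2) := Or.inr rfl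

theorem lozAdj.height {l : Loz} (h : lozAdj l) : l.2.2 = l.1.2 ∨ l.2.2 = l.1.2 - 1 := by
  rcases h with h | h | h <;> rw [h] <;> simp

theorem covers_vertLoz_true {i j : ℕ} {t : Tri} (ht : t.1 = true) (hi : Covers (vertLoz i) t)
    (hj : Covers (vertLoz j) t) : i = j := by
  rcases hi with rfl | rfl <;> rcases hj with h | h <;> simp_all [upT, dnT, vertLoz]

theorem covers_vertLoz_false {i j : ℕ} {t : Tri} (ht : t.1 = false) (hi : Covers (vertLoz i) t)
    (hj : Covers (vertLoz j) t) : i = j := by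
  rcases hi with rfl | rfl <;> rcases hj with h | h <;> simp_all [upT, dnT, vertLoz]

theorem covers_vertLoz_of_nonneg {i : ℕ} {t : Tri} (ht : 0 ≤ t.2.2) (hi : Covers (vertLoz i) t) :
    t.1 = true := by
  rcases hi with rfl | rfl
  · rfl
  · simp [dnT, vertLoz] at ht

theorem covers_vertLoz_of_neg {i : ℕ} {t : Tri} (ht : t.2.2 < 0) (hi : Covers (vertLoz i) t) :
    t.1 = false := by
  rcases hi with rfl | rfl
  · simp [upT, vertLoz] at ht
  · rfl

theorem isTiling_glue (h₁ : ∀ t ∈ R₁, 0 ≤ t.2.2) (h₂ : ∀ t ∈ R₂, t.2.2 < 0)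
    (hS : ∀ i ∈ S, upT ((i : ℤ) - 1) 0 ∈ R₁ ∧ dnT ((i : ℤ) - 1) (-1) ∈ R₂)
    {T₁ T₂ : Finset Loz} (hT₁ : IsTiling (R₁ \ upDents S) T₁)
    (hT₂ : IsTiling (R₂ \ dnDents S) T₂) :
    IsTiling (R₁ ∪ R₂) (barrierLoz S ∪ (T₁ ∪ T₂)) := by
  rw [isTiling_iff] at hT₁ hT₂ ⊢
  obtain ⟨a₁, b₁⟩ := hT₁
  obtain ⟨a₂, b₂⟩ := hT₂
  simp only [mem_union, barrierLoz_eq, mem_image]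
  refine ⟨?_, ?_⟩
  · rintro l (⟨i, hi, rfl⟩ | hl | hl)
    · refine ⟨Or.inr (Or.inr rfl), ?_⟩
      rintro t (rfl | rfl)
      · exact Or.inl (hS i hi).1
      · exact Or.inr (hS i hi).2
    · exact ⟨(a₁ l hl).1, fun t ht => Or.inl (mem_sdiff.1 ((a₁ l hl).2 t ht)).1⟩
    · exact ⟨(a₂ l hl).1, fun t ht => Or.inr (mem_sdiff.1 ((a₂ l hl).2 t ht)).1⟩
  · rintro t (ht | ht)
    · have hpos := h₁ t ht
      have no₂ : ∀ l ∈ T₂, ¬ Covers l t := fun l hl hc => by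
        have := h₂ t (mem_sdiff.1 ((a₂ l hl).2 t hc)).1
        omega
      by_cases hd : t ∈ upDents S
      · have no₁ : ∀ l ∈ T₁, ¬ Covers l t := fun l hl hc =>
          (mem_sdiff.1 ((a₁ l hl).2 t hc)).2 hd
        obtain ⟨i, hi, hc, htt⟩ := mem_upDents.1 hd
        refine ⟨vertLoz i, ⟨Or.inl ⟨i, hi, rfl⟩, hc⟩, ?_⟩
        rintro l ⟨⟨j, hj, rfl⟩ | hl | hl, hc'⟩
        · rw [covers_vertLoz_true htt hc hc']
        · exact absurd hc' (no₁ l hl)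
        · exact absurd hc' (no₂ l hl)
      · obtain ⟨l, ⟨hl, hc⟩, hu⟩ := b₁ t (mem_sdiff.2 ⟨ht, hd⟩)
        refine ⟨l, ⟨Or.inr (Or.inl hl), hc⟩, ?_⟩
        rintro l' ⟨⟨j, hj, rfl⟩ | hl' | hl', hc'⟩
        · exact absurd (mem_upDents.2 ⟨j, hj, hc', covers_vertLoz_of_nonneg hpos hc'⟩) hd
        · exact hu l' ⟨hl', hc'⟩
        · exact absurd hc' (no₂ l' hl')
    · have hneg := h₂ t ht
      have no₁ : ∀ l ∈ T₁, ¬ Covers l t := fun l hl hc => by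
        have := h₁ t (mem_sdiff.1 ((a₁ l hl).2 t hc)).1
        omega
      by_cases hd : t ∈ dnDents S
      · have no₂ : ∀ l ∈ T₂, ¬ Covers l t := fun l hl hc =>
          (mem_sdiff.1 ((a₂ l hl).2 t hc)).2 hd
        obtain ⟨i, hi, hc, htt⟩ := mem_dnDents.1 hd
        refine ⟨vertLoz i, ⟨Or.inl ⟨i, hi, rfl⟩, hc⟩, ?_⟩
        rintro l ⟨⟨j, hj, rfl⟩ | hl | hl, hc'⟩
        · rw [covers_vertLoz_false htt hc hc']
        · exact absurd hc' (no₁ l hl)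
        · exact absurd hc' (no₂ l hl)
      · obtain ⟨l, ⟨hl, hc⟩, hu⟩ := b₂ t (mem_sdiff.2 ⟨ht, hd⟩)
        refine ⟨l, ⟨Or.inr (Or.inr hl), hc⟩, ?_⟩
        rintro l' ⟨⟨j, hj, rfl⟩ | hl' | hl', hc'⟩
        · exact absurd (mem_dnDents.2 ⟨j, hj, hc', covers_vertLoz_of_neg hneg hc'⟩) hd
        · exact absurd hc' (no₁ l' hl')
        · exact hu l' ⟨hl', hc'⟩

/-- A lozenge of a tiling of `R₁ ∪ R₂` lies above the cut, below it, or straddles it. -/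
theorem eq_vertLoz_of_straddle (h₁ : ∀ t ∈ R₁, 0 ≤ t.2.2) (h₂ : ∀ t ∈ R₂, t.2.2 < 0)
    (hC : ∀ i : ℤ, upT i 0 ∈ R₁ ∧ dnT i (-1) ∈ R₂ ↔ ∃ c ∈ C, (c : ℤ) - 1 = i)
    {l : Loz} (hl : lozAdj l) (hcov : ∀ t, Covers l t → t ∈ R₁ ∪ R₂)
    (hlo : l.2.2 < 0) (hhi : 0 ≤ l.1.2) : ∃ c ∈ C, l = vertLoz c := by
  obtain ⟨⟨a, b⟩, c, d⟩ := l
  have hb : b = 0 := by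
    have := hl.height
    simp only at *
    omega
  subst hb
  have e : (c, d) = (a, -1) := by
    rcases hl with h | h | h <;> simp_all
  obtain ⟨rfl, rfl⟩ := Prod.mk.inj e
  have m₁ : upT c 0 ∈ R₁ := (mem_union.1 (hcov _ (Or.inl rfl))).resolve_right fun h => by
    have := h₂ _ h
    simp [upT] at this
  have m₂ : dnT c (-1) ∈ R₂ := (mem_union.1 (hcov _ (Or.inr rfl))).resolve_left fun h => by
    have := h₁ _ h
    simp [dnT] at this
  obtain ⟨k, hk, rfl⟩ := (hC c).1 ⟨m₁, m₂⟩
  exact ⟨k, hk, rfl⟩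

theorem isTiling_split (h₁ : ∀ t ∈ R₁, 0 ≤ t.2.2) (h₂ : ∀ t ∈ R₂, t.2.2 < 0)
    (hC : ∀ i : ℤ, upT i 0 ∈ R₁ ∧ dnT i (-1) ∈ R₂ ↔ ∃ c ∈ C, (c : ℤ) - 1 = i)
    {T : Finset Loz} (hT : IsTiling (R₁ ∪ R₂) T) :
    IsTiling (R₁ \ upDents (C.filter (vertLoz · ∈ T))) (T.filter (0 ≤ ·.2.2)) ∧
    IsTiling (R₂ \ dnDents (C.filter (vertLoz · ∈ T))) (T.filter (·.1.2 < 0)) ∧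
    barrierLoz (C.filter (vertLoz · ∈ T)) ∪ (T.filter (0 ≤ ·.2.2) ∪ T.filter (·.1.2 < 0)) = T := by
  rw [isTiling_iff] at hT
  obtain ⟨ha, hb⟩ := hT
  have str : ∀ l ∈ T, l.2.2 < 0 → 0 ≤ l.1.2 → ∃ c ∈ C.filter (vertLoz · ∈ T), l = vertLoz c := by
    intro l hl hlo hhi
    obtain ⟨c, hc, rfl⟩ := eq_vertLoz_of_straddle h₁ h₂ hC (ha l hl).1 (ha l hl).2 hlo hhi
    exact ⟨c, mem_filter.2 ⟨hc, hl⟩, rfl⟩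
  refine ⟨?_, ?_, ?_⟩
  · rw [isTiling_iff]
    refine ⟨fun l hl => ?_, fun t ht => ?_⟩
    · obtain ⟨hl, hpos⟩ := mem_filter.1 hl
      refine ⟨(ha l hl).1, fun t hc => ?_⟩
      have htR := (ha l hl).2 t hc
      have htpos : 0 ≤ t.2.2 := by
        have := (ha l hl).1.height
        have := hc.height
        omega
      refine mem_sdiff.2 ⟨(mem_union.1 htR).resolve_right fun h => ?_, fun h => ?_⟩
      · have := h₂ t h
        omega
      · obtain ⟨i, hi, hci, -⟩ := mem_upDents.1 h
        rw [(hb t htR).unique ⟨hl, hc⟩ ⟨(mem_filter.1 hi).2, hci⟩] at hpos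
        simp [vertLoz] at hpos
    · obtain ⟨ht, hd⟩ := mem_sdiff.1 ht
      have hpos := h₁ t ht
      obtain ⟨l, ⟨hl, hc⟩, hu⟩ := hb t (mem_union_left _ ht)
      refine ⟨l, ⟨mem_filter.2 ⟨hl, ?_⟩, hc⟩, fun l' hl' => hu l' ⟨(mem_filter.1 hl'.1).1, hl'.2⟩⟩
      by_contra hneg
      have := hc.height
      obtain ⟨i, hi, rfl⟩ := str l hl (by omega) (by omega)
      exact hd (mem_upDents.2 ⟨i, hi, hc, covers_vertLoz_of_nonneg hpos hc⟩)
  · rw [isTiling_iff]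
    refine ⟨fun l hl => ?_, fun t ht => ?_⟩
    · obtain ⟨hl, hneg⟩ := mem_filter.1 hl
      refine ⟨(ha l hl).1, fun t hc => ?_⟩
      have htR := (ha l hl).2 t hc
      have htneg : t.2.2 < 0 := by
        have := (ha l hl).1.height
        have := hc.height
        omega
      refine mem_sdiff.2 ⟨(mem_union.1 htR).resolve_left fun h => ?_, fun h => ?_⟩
      · have := h₁ t h
        omega
      · obtain ⟨i, hi, hci, -⟩ := mem_dnDents.1 h
        rw [(hb t htR).unique ⟨hl, hc⟩ ⟨(mem_filter.1 hi).2, hci⟩] at hneg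
        simp [vertLoz] at hneg
    · obtain ⟨ht, hd⟩ := mem_sdiff.1 ht
      have hneg := h₂ t ht
      obtain ⟨l, ⟨hl, hc⟩, hu⟩ := hb t (mem_union_right _ ht)
      refine ⟨l, ⟨mem_filter.2 ⟨hl, ?_⟩, hc⟩, fun l' hl' => hu l' ⟨(mem_filter.1 hl'.1).1, hl'.2⟩⟩
      by_contra hpos
      have := hc.height
      obtain ⟨i, hi, rfl⟩ := str l hl (by omega) (by omega)
      exact hd (mem_dnDents.2 ⟨i, hi, hc, covers_vertLoz_of_neg hneg hc⟩)
  · ext l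
    simp only [mem_union, mem_filter, barrierLoz_eq, mem_image]
    constructor
    · rintro (⟨i, ⟨-, hi⟩, rfl⟩ | h | h)
      exacts [hi, h.1, h.1]
    · intro hl
      by_cases h1 : 0 ≤ l.2.2
      · exact Or.inr (Or.inl ⟨hl, h1⟩)
      by_cases h2 : l.1.2 < 0
      · exact Or.inr (Or.inr ⟨hl, h2⟩)
      obtain ⟨c, hc, rfl⟩ := str l hl (by omega) (by omega)
      exact Or.inl ⟨c, mem_filter.1 hc, rfl⟩

/-- Cutting a region along the line at height `0`: sum over the set of positions at which a
vertical lozenge straddles that line. -/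
theorem Mtil_union (B : Finset ℕ) (h₁ : ∀ t ∈ R₁, 0 ≤ t.2.2) (h₂ : ∀ t ∈ R₂, t.2.2 < 0)
    (hC : ∀ i : ℤ, upT i 0 ∈ R₁ ∧ dnT i (-1) ∈ R₂ ↔ ∃ c ∈ C, (c : ℤ) - 1 = i) :
    Mtil (R₁ ∪ R₂) (barrierLoz B) =
      ∑ S ∈ (C \ B).powerset, Mtil (R₁ \ upDents S) ∅ * Mtil (R₂ \ dnDents S) ∅ := by
  have above : ∀ {S : Finset ℕ} {T₁ : Finset Loz}, IsTiling (R₁ \ upDents S) T₁ →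
      ∀ l ∈ T₁, 0 ≤ l.1.2 ∧ 0 ≤ l.2.2 := fun h l hl =>
    ⟨h₁ _ (mem_sdiff.1 (h.1 l hl).2.1).1, h₁ _ (mem_sdiff.1 (h.1 l hl).2.2).1⟩
  have below : ∀ {S : Finset ℕ} {T₂ : Finset Loz}, IsTiling (R₂ \ dnDents S) T₂ →
      ∀ l ∈ T₂, l.1.2 < 0 ∧ l.2.2 < 0 := fun h l hl =>
    ⟨h₂ _ (mem_sdiff.1 (h.1 l hl).2.1).1, h₂ _ (mem_sdiff.1 (h.1 l hl).2.2).1⟩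
  have vert : ∀ i : ℕ, (vertLoz i).1.2 = 0 ∧ (vertLoz i).2.2 = -1 := fun i => ⟨rfl, rfl⟩
  simp only [Mtil, ← card_product]
  rw [← card_sigma]
  symm
  refine card_bij (fun p _ => barrierLoz p.1 ∪ (p.2.1 ∪ p.2.2)) ?_ ?_ ?_
  · rintro ⟨S, T₁, T₂⟩ h
    simp only [mem_sigma, mem_product, mem_tilings, mem_powerset, notMem_empty, not_false_eq_true,
      implies_true, and_true] at h
    obtain ⟨hS, hT₁, hT₂⟩ := h
    refine mem_tilings.2 ⟨isTiling_glue h₁ h₂ (fun i hi =>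
      (hC _).2 ⟨i, (mem_sdiff.1 (hS hi)).1, rfl⟩) hT₁ hT₂, ?_⟩
    simp only [mem_union, barrierLoz_eq, mem_image]
    rintro l hl ⟨j, hj, rfl⟩
    have := vert j
    rcases hl with ⟨i, hi, hij⟩ | hl | hl
    · rw [vertLoz_injective hij] at hi
      exact (mem_sdiff.1 (hS hi)).2 hj
    · have := above hT₁ _ hl
      omega
    · have := below hT₂ _ hl
      omega
  · rintro ⟨S, T₁, T₂⟩ h ⟨S', T₁', T₂'⟩ h' heq
    simp only [mem_sigma, mem_product, mem_tilings, mem_powerset, notMem_empty, not_false_eq_true,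
      implies_true, and_true] at h h'
    obtain ⟨-, hT₁, hT₂⟩ := h
    obtain ⟨-, hT₁', hT₂'⟩ := h'
    simp only [Finset.ext_iff, mem_union, barrierLoz_eq, mem_image] at heq
    have a := above hT₁
    have a' := above hT₁'
    have b := below hT₂
    have b' := below hT₂'
    have eS : S = S' := by
      ext i
      have := heq (vertLoz i)
      have := vert i
      have := fun j (h : vertLoz j = vertLoz i) => vertLoz_injective h
      grind
    have e₁ : T₁ = T₁' := by
      ext l
      have := heq l
      grind
    have e₂ : T₂ = T₂' := by
      ext l
      have := heq l
      grind
    subst eS e₁ e₂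
    rfl
  · intro T hT
    obtain ⟨hT, hF⟩ := mem_tilings.1 hT
    obtain ⟨t₁, t₂, e⟩ := isTiling_split h₁ h₂ hC hT
    refine ⟨⟨C.filter (vertLoz · ∈ T), T.filter (0 ≤ ·.2.2), T.filter (·.1.2 < 0)⟩, ?_, e⟩
    simp only [mem_sigma, mem_product, mem_tilings, mem_powerset, notMem_empty, not_false_eq_true,
      implies_true, and_true]
    refine ⟨fun i hi => ?_, t₁, t₂⟩
    obtain ⟨hi, hv⟩ := mem_filter.1 hi
    exact mem_sdiff.2 ⟨hi, fun hB => hF _ hv (mem_image_of_mem _ hB)⟩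

end Cut

/-- The row of unit triangles just below the line at height `0`, with `W + 1` up-pointing
and `W` down-pointing triangles, the up-pointing ones at the positions of `A` being removed. -/
def rowReg (W : ℕ) (A : Finset ℕ) : Finset Tri :=
  ((Icc 1 (W + 1) \ A).image fun i : ℕ => upT ((i : ℤ) - 1) (-1)) ∪
    (Icc 1 W).image fun i : ℕ => dnT ((i : ℤ) - 1) (-1)

/-- The lozenge in the row below height `0` whose two triangles are at position `c`. -/
def rightLoz (c : ℕ) : Loz := (((c : ℤ) - 1, -1), ((c : ℤ) - 1, -1))

/-- The lozenge in the row below height `0` whose up-pointing triangle is at position `c + 1`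
and whose down-pointing triangle is at position `c`. -/
def leftLoz (c : ℕ) : Loz := (((c : ℤ), -1), ((c : ℤ) - 1, -1))

theorem mem_rowReg_sdiff {W : ℕ} {A S : Finset ℕ} {t : Tri} :
    t ∈ rowReg W A \ dnDents S ↔
      (∃ c ∈ Icc 1 (W + 1), c ∉ A ∧ t = upT ((c : ℤ) - 1) (-1)) ∨
        ∃ c ∈ Icc 1 W, c ∉ S ∧ t = dnT ((c : ℤ) - 1) (-1) := by
  unfold rowReg dnDents upT dnT
  simp only [mem_sdiff, mem_union, mem_image]
  constructor
  · grind
  · rintro (⟨c, hc, hA, rfl⟩ | ⟨c, hc, hS, rfl⟩)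
    · exact ⟨Or.inl ⟨c, ⟨hc, hA⟩, rfl⟩, by simp⟩
    · refine ⟨Or.inr ⟨c, hc, rfl⟩, ?_⟩
      rintro ⟨i, hi, h⟩
      have : i = c := by simpa using h
      exact hS (this ▸ hi)

theorem covers_rightLoz {c : ℕ} {t : Tri} : Covers (rightLoz c) t ↔
    t = upT ((c : ℤ) - 1) (-1) ∨ t = dnT ((c : ℤ) - 1) (-1) := Iff.rfl

theorem covers_leftLoz {c : ℕ} {t : Tri} : Covers (leftLoz c) t ↔
    t = upT (c : ℤ) (-1) ∨ t = dnT ((c : ℤ) - 1) (-1) := Iff.rfl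

theorem upT_inj {a b a' b' : ℤ} : upT a b = upT a' b' ↔ a = a' ∧ b = b' := by simp [upT]

theorem dnT_inj {a b a' b' : ℤ} : dnT a b = dnT a' b' ↔ a = a' ∧ b = b' := by simp [dnT]

theorem upT_ne_dnT {a b a' b' : ℤ} : upT a b ≠ dnT a' b' := by simp [upT, dnT]

theorem leftLoz_ne_rightLoz (c c' : ℕ) : leftLoz c ≠ rightLoz c' := by
  simp only [leftLoz, rightLoz, ne_eq, Prod.mk.injEq]
  omega

theorem leftLoz_injective : Function.Injective leftLoz := fun i j h => by
  simpa [leftLoz] using h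

theorem rightLoz_injective : Function.Injective rightLoz := fun i j h => by
  simpa [rightLoz] using h

theorem sum_ite_eq_one {p q r : Prop} [Decidable p] [Decidable q] [Decidable r]
    (h : p ∨ q ↔ ¬ r) (h' : ¬ (p ∧ q)) :
    (if p then 1 else 0) + (if q then 1 else 0) + (if r then 1 else 0) = 1 := by
  by_cases p <;> by_cases q <;> by_cases r <;> simp_all

theorem isTiling_row_iff {W : ℕ} {A S : Finset ℕ} {T : Finset Loz} :
    IsTiling (rowReg W A \ dnDents S) T ↔
      (∀ l ∈ T, ∃ c ∈ Icc 1 W, l = rightLoz c ∨ l = leftLoz c) ∧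
      (∀ c ∈ Icc 1 (W + 1), (if rightLoz c ∈ T then 1 else 0) +
        (if leftLoz (c - 1) ∈ T then 1 else 0) + (if c ∈ A then 1 else 0) = 1) ∧
      (∀ c ∈ Icc 1 W, (if rightLoz c ∈ T then 1 else 0) +
        (if leftLoz c ∈ T then 1 else 0) + (if c ∈ S then 1 else 0) = 1) := by
  rw [isTiling_iff]
  simp only [mem_rowReg_sdiff]
  constructor
  · rintro ⟨ha, hb⟩
    have hform : ∀ l ∈ T, ∃ c ∈ Icc 1 W, l = rightLoz c ∨ l = leftLoz c := by
      intro l hl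
      obtain ⟨hadj, hc⟩ := ha l hl
      obtain ⟨⟨a, b⟩, a', b'⟩ := l
      have hu := hc _ (covers_fst _)
      have hd := hc _ (covers_snd _)
      simp only [upT_inj, upT_ne_dnT, upT_ne_dnT.symm, dnT_inj, and_false, exists_false, or_false,
        false_or] at hu hd
      obtain ⟨c, hc, -, rfl, rfl⟩ := hu
      obtain ⟨c', hc', -, rfl, rfl⟩ := hd
      refine ⟨c', hc', ?_⟩
      simp only [lozAdj, rightLoz, leftLoz, Prod.mk.injEq, and_true] at hadj ⊢
      omega
    have hcov : ∀ l ∈ T, ∀ t, Covers l t → ∃! l, l ∈ T ∧ Covers l t := fun l hl t hc =>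
      hb t ((ha l hl).2 t hc)
    refine ⟨hform, fun c hc => ?_, fun c hc => ?_⟩
    · obtain ⟨k, rfl⟩ : ∃ k, c = k + 1 := ⟨c - 1, by have := (mem_Icc.1 hc).1; omega⟩
      have cr : Covers (rightLoz (k + 1)) (upT (k : ℤ) (-1)) := Or.inl (by simp [rightLoz])
      have cl : Covers (leftLoz k) (upT (k : ℤ) (-1)) := Or.inl rfl
      have hnot : (rightLoz (k + 1) ∈ T ∨ leftLoz k ∈ T) ↔ k + 1 ∉ A := by
        constructor
        · intro h
          have : ∃ l ∈ T, Covers l (upT (k : ℤ) (-1)) :=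
            h.elim (fun h => ⟨_, h, cr⟩) (fun h => ⟨_, h, cl⟩)
          obtain ⟨l, hl, hc⟩ := this
          have := (ha l hl).2 _ hc
          simp only [upT_inj, upT_ne_dnT, and_false, exists_false, or_false] at this
          obtain ⟨c, -, hcA, hk, -⟩ := this
          rwa [show k + 1 = c by omega]
        · intro h
          obtain ⟨l, ⟨hl, hcl⟩, -⟩ := hb (upT (k : ℤ) (-1))
            (Or.inl ⟨k + 1, hc, h, by simp⟩)
          obtain ⟨c, -, rfl | rfl⟩ := hform l hl
          · simp only [covers_rightLoz, upT_inj, upT_ne_dnT, or_false] at hcl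
            rw [show k + 1 = c by omega]
            exact Or.inl hl
          · simp only [covers_leftLoz, upT_inj, upT_ne_dnT, or_false] at hcl
            rw [show k = c by omega]
            exact Or.inr hl
      have hboth : ¬ (rightLoz (k + 1) ∈ T ∧ leftLoz k ∈ T) := fun ⟨h, h'⟩ =>
        leftLoz_ne_rightLoz _ _ ((hcov _ h _ cr).unique ⟨h', cl⟩ ⟨h, cr⟩)
      exact sum_ite_eq_one hnot hboth
    · have cr : Covers (rightLoz c) (dnT ((c : ℤ) - 1) (-1)) := Or.inr rfl
      have cl : Covers (leftLoz c) (dnT ((c : ℤ) - 1) (-1)) := Or.inr rfl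
      have hnot : (rightLoz c ∈ T ∨ leftLoz c ∈ T) ↔ c ∉ S := by
        constructor
        · intro h
          have : ∃ l ∈ T, Covers l (dnT ((c : ℤ) - 1) (-1)) :=
            h.elim (fun h => ⟨_, h, cr⟩) (fun h => ⟨_, h, cl⟩)
          obtain ⟨l, hl, hc⟩ := this
          have := (ha l hl).2 _ hc
          simp only [dnT_inj, upT_ne_dnT.symm, and_false, exists_false, false_or] at this
          obtain ⟨c', -, hcS, hk, -⟩ := this
          rwa [show c = c' by omega]
        · intro h
          obtain ⟨l, ⟨hl, hcl⟩, -⟩ := hb (dnT ((c : ℤ) - 1) (-1)) (Or.inr ⟨c, hc, h, rfl⟩)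
          obtain ⟨c', -, rfl | rfl⟩ := hform l hl
          · simp only [covers_rightLoz, dnT_inj, upT_ne_dnT.symm, false_or] at hcl
            rw [show c = c' by omega]
            exact Or.inl hl
          · simp only [covers_leftLoz, dnT_inj, upT_ne_dnT.symm, false_or] at hcl
            rw [show c = c' by omega]
            exact Or.inr hl
      have hboth : ¬ (rightLoz c ∈ T ∧ leftLoz c ∈ T) := fun ⟨h, h'⟩ =>
        leftLoz_ne_rightLoz _ _ ((hcov _ h _ cr).unique ⟨h', cl⟩ ⟨h, cr⟩)
      exact sum_ite_eq_one hnot hboth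
  · rintro ⟨hform, hU, hD⟩
    refine ⟨?_, ?_⟩
    · intro l hl
      obtain ⟨c, hc, rfl | rfl⟩ := hform l hl
      · refine ⟨Or.inl rfl, ?_⟩
        have h₁ := hU c (by simp only [mem_Icc] at hc ⊢; omega)
        have h₂ := hD c hc
        rw [if_pos hl] at h₁ h₂
        rintro t (rfl | rfl)
        · refine Or.inl ⟨c, by simp only [mem_Icc] at hc ⊢; omega, fun h => ?_, rfl⟩
          rw [if_pos h] at h₁
          omega
        · refine Or.inr ⟨c, hc, fun h => ?_, rfl⟩
          rw [if_pos h] at h₂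
          omega
      · refine ⟨Or.inr (Or.inl rfl), ?_⟩
        have h₁ := hU (c + 1) (by simp only [mem_Icc] at hc ⊢; omega)
        have h₂ := hD c hc
        rw [add_tsub_cancel_right, if_pos hl] at h₁
        rw [if_pos hl] at h₂
        rintro t (rfl | rfl)
        · refine Or.inl ⟨c + 1, by simp only [mem_Icc] at hc ⊢; omega, fun h => ?_,
            by simp [leftLoz]⟩
          rw [if_pos h] at h₁
          omega
        · refine Or.inr ⟨c, hc, fun h => ?_, rfl⟩
          rw [if_pos h] at h₂
          omega
    · rintro t (⟨c, hc, hA, rfl⟩ | ⟨c, hc, hS, rfl⟩)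
      · obtain ⟨k, rfl⟩ : ∃ k, c = k + 1 := ⟨c - 1, by have := (mem_Icc.1 hc).1; omega⟩
        have h₁ := hU _ hc
        rw [add_tsub_cancel_right, if_neg hA] at h₁
        by_cases hr : rightLoz (k + 1) ∈ T
        · refine ⟨_, ⟨hr, Or.inl rfl⟩, ?_⟩
          rintro l ⟨hl, hcl⟩
          obtain ⟨c', -, rfl | rfl⟩ := hform l hl
          · simp only [covers_rightLoz, upT_inj, upT_ne_dnT, or_false] at hcl
            rw [show k + 1 = c' by omega]
          · simp only [covers_leftLoz, upT_inj, upT_ne_dnT, or_false] at hcl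
            rw [if_pos hr, if_pos (by rwa [show k = c' by omega])] at h₁
            omega
        · have hl : leftLoz k ∈ T := by
            by_contra h
            rw [if_neg hr, if_neg h] at h₁
            omega
          refine ⟨_, ⟨hl, Or.inl (by simp [leftLoz])⟩, ?_⟩
          rintro l ⟨hl, hcl⟩
          obtain ⟨c', -, rfl | rfl⟩ := hform l hl
          · simp only [covers_rightLoz, upT_inj, upT_ne_dnT, or_false] at hcl
            exact absurd (by rwa [show k + 1 = c' by omega]) hr
          · simp only [covers_leftLoz, upT_inj, upT_ne_dnT, or_false] at hcl
            rw [show k = c' by omega]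
      · have h₂ := hD _ hc
        rw [if_neg hS] at h₂
        by_cases hr : rightLoz c ∈ T
        · refine ⟨_, ⟨hr, Or.inr rfl⟩, ?_⟩
          rintro l ⟨hl, hcl⟩
          obtain ⟨c', -, rfl | rfl⟩ := hform l hl
          · simp only [covers_rightLoz, dnT_inj, upT_ne_dnT.symm, false_or] at hcl
            rw [show c = c' by omega]
          · simp only [covers_leftLoz, dnT_inj, upT_ne_dnT.symm, false_or] at hcl
            rw [if_pos hr, if_pos (by rwa [show c = c' by omega])] at h₂
            omega
        · have hl : leftLoz c ∈ T := by
            by_contra h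
            rw [if_neg hr, if_neg h] at h₂
            omega
          refine ⟨_, ⟨hl, Or.inr rfl⟩, ?_⟩
          rintro l ⟨hl, hcl⟩
          obtain ⟨c', -, rfl | rfl⟩ := hform l hl
          · simp only [covers_rightLoz, dnT_inj, upT_ne_dnT.symm, false_or] at hcl
            exact absurd (by rwa [show c = c' by omega]) hr
          · simp only [covers_leftLoz, dnT_inj, upT_ne_dnT.symm, false_or] at hcl
            rw [show c = c' by omega]

/-- The number of elements of `A` that are at most `c`. -/
def cnt (A : Finset ℕ) (c : ℕ) : ℕ := (A.filter (· ≤ c)).card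

theorem cnt_succ (A : Finset ℕ) (c : ℕ) :
    cnt A (c + 1) = cnt A c + if c + 1 ∈ A then 1 else 0 := by
  unfold cnt
  have : A.filter (· ≤ c + 1) = A.filter (· ≤ c) ∪ A.filter (· = c + 1) := by
    ext a
    simp only [mem_filter, mem_union, ← and_or_left, Nat.le_succ_iff]
  rw [this, card_union_of_disjoint, filter_eq']
  · split_ifs <;> simp
  · rw [disjoint_filter]
    rintro a - h rfl
    exact absurd h (by omega)

theorem cnt_zero {A : Finset ℕ} (h : ∀ a ∈ A, 1 ≤ a) : cnt A 0 = 0 := by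
  unfold cnt
  rw [card_eq_zero, filter_eq_empty_iff]
  intro a ha
  have := h a ha
  omega

theorem cnt_of_le {A : Finset ℕ} {c : ℕ} (h : ∀ a ∈ A, a ≤ c) : cnt A c = A.card := by
  unfold cnt
  rw [filter_true_of_mem h]

/-- `S` interlaces with `A`, expressed through counting functions. -/
def Interlace (A S : Finset ℕ) : Prop :=
  A.card = S.card + 1 ∧ ∀ c, cnt S (c + 1) ≤ cnt A (c + 1) ∧ cnt A (c + 1) ≤ cnt S c + 1

theorem IsTiling.row {W : ℕ} {A S : Finset ℕ} {T : Finset Loz}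
    (hA : A ⊆ Icc 1 (W + 1)) (hS : S ⊆ Icc 1 W) (hT : IsTiling (rowReg W A \ dnDents S) T) :
    Interlace A S ∧ ∀ c < W, (rightLoz (c + 1) ∈ T ↔ cnt A (c + 1) = cnt S c) ∧
      (leftLoz (c + 1) ∈ T ↔ cnt A (c + 1) = cnt S (c + 1) + 1) := by
  obtain ⟨hform, hU, hD⟩ := isTiling_row_iff.1 hT
  have hA0 : cnt A 0 = 0 := cnt_zero fun a ha => (mem_Icc.1 (hA ha)).1
  have hS0 : cnt S 0 = 0 := cnt_zero fun a ha => (mem_Icc.1 (hS ha)).1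
  have hl0 : leftLoz 0 ∉ T := fun h => by
    obtain ⟨c, hc, e | e⟩ := hform _ h
    · exact leftLoz_ne_rightLoz _ _ e
    · rw [← leftLoz_injective e] at hc
      simp at hc
  have hrW : rightLoz (W + 1) ∉ T := fun h => by
    obtain ⟨c, hc, e | e⟩ := hform _ h
    · rw [← rightLoz_injective e] at hc
      simp at hc
    · exact leftLoz_ne_rightLoz _ _ e.symm
  have hflux : ∀ c ≤ W, (if leftLoz c ∈ T then 1 else 0) + cnt S c = cnt A c := by
    intro c
    induction c with
    | zero => simp [hA0, hS0, hl0]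
    | succ c ih =>
      intro hc
      have h₁ := hU (c + 1) (by simp only [mem_Icc]; omega)
      have h₂ := hD (c + 1) (by simp only [mem_Icc]; omega)
      have h₃ := ih (by omega)
      rw [add_tsub_cancel_right] at h₁
      rw [cnt_succ, cnt_succ]
      omega
  have hR : ∀ c ≤ W, (if rightLoz (c + 1) ∈ T then 1 else 0) + cnt A (c + 1) = cnt S c + 1 := by
    intro c hc
    have h₁ := hU (c + 1) (by simp only [mem_Icc]; omega)
    have h₂ := hflux c hc
    rw [add_tsub_cancel_right] at h₁
    rw [cnt_succ]
    omega
  have hAW : ∀ c, W ≤ c → cnt A (c + 1) = A.card := fun c hc =>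
    cnt_of_le fun a ha => by
      have := (mem_Icc.1 (hA ha)).2
      omega
  have hSW : ∀ c, W ≤ c → cnt S c = S.card := fun c hc =>
    cnt_of_le fun a ha => by
      have := (mem_Icc.1 (hS ha)).2
      omega
  have hcard : A.card = S.card + 1 := by
    have := hR W le_rfl
    rwa [hAW W le_rfl, hSW W le_rfl, if_neg hrW, zero_add] at this
  refine ⟨⟨hcard, fun c => ?_⟩, fun c hc => ?_⟩
  · by_cases hc : c < W
    · have := hflux (c + 1) hc
      have := hR c hc.le
      omega
    · rw [hAW c (by omega), hSW c (by omega), hSW (c + 1) (by omega)]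
      omega
  · have h₁ := hflux (c + 1) hc
    have h₂ := hR c hc.le
    constructor
    · split_ifs at h₂ with h <;> simp only [h, true_iff, false_iff] <;> omega
    · split_ifs at h₁ with h <;> simp only [h, true_iff, false_iff] <;> omega

theorem exists_isTiling_row {W : ℕ} {A S : Finset ℕ}
    (hA : A ⊆ Icc 1 (W + 1)) (hS : S ⊆ Icc 1 W) (h : Interlace A S) :
    ∃ T, IsTiling (rowReg W A \ dnDents S) T := by
  classical
  obtain ⟨hcard, hI⟩ := h
  have hA0 : cnt A 0 = 0 := cnt_zero fun a ha => (mem_Icc.1 (hA ha)).1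
  have hS0 : cnt S 0 = 0 := cnt_zero fun a ha => (mem_Icc.1 (hS ha)).1
  refine ⟨((Icc 1 W).filter fun c => cnt A c = cnt S (c - 1)).image rightLoz ∪
    ((Icc 1 W).filter fun c => cnt A c = cnt S c + 1).image leftLoz, isTiling_row_iff.2 ?_⟩
  have hr : ∀ c, rightLoz c ∈ ((Icc 1 W).filter fun c => cnt A c = cnt S (c - 1)).image rightLoz ∪
      ((Icc 1 W).filter fun c => cnt A c = cnt S c + 1).image leftLoz ↔
      (1 ≤ c ∧ c ≤ W) ∧ cnt A c = cnt S (c - 1) := by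
    intro c
    rw [mem_union, rightLoz_injective.mem_finset_image, or_iff_left, mem_filter, mem_Icc]
    simp [leftLoz_ne_rightLoz]
  have hl : ∀ c, leftLoz c ∈ ((Icc 1 W).filter fun c => cnt A c = cnt S (c - 1)).image rightLoz ∪
      ((Icc 1 W).filter fun c => cnt A c = cnt S c + 1).image leftLoz ↔
      (1 ≤ c ∧ c ≤ W) ∧ cnt A c = cnt S c + 1 := by
    intro c
    rw [mem_union, leftLoz_injective.mem_finset_image, or_iff_right, mem_filter, mem_Icc]
    simp [(leftLoz_ne_rightLoz _ _).symm]
  refine ⟨?_, ?_, ?_⟩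
  · intro l hl
    simp only [mem_union, mem_image, mem_filter] at hl
    rcases hl with ⟨c, ⟨hc, -⟩, rfl⟩ | ⟨c, ⟨hc, -⟩, rfl⟩
    exacts [⟨c, hc, Or.inl rfl⟩, ⟨c, hc, Or.inr rfl⟩]
  · intro c hc
    obtain ⟨k, rfl⟩ : ∃ k, c = k + 1 := ⟨c - 1, by have := (mem_Icc.1 hc).1; omega⟩
    simp only [hr, hl, add_tsub_cancel_right]
    have h₁ := hI k
    have h₂ := hI (k - 1)
    have h₃ := cnt_succ A k
    have hkW := (mem_Icc.1 hc).2
    have h₄ : k = W → cnt A (k + 1) = cnt S k + 1 := by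
      rintro rfl
      rw [cnt_of_le fun a ha => (mem_Icc.1 (hA ha)).2, cnt_of_le fun a ha => (mem_Icc.1 (hS ha)).2,
        hcard]
    rcases Nat.eq_zero_or_pos k with rfl | hk
    · split_ifs at * <;> omega
    · rw [Nat.sub_add_cancel hk] at h₂
      have h₅ := cnt_succ S (k - 1)
      rw [Nat.sub_add_cancel hk] at h₅
      split_ifs at * <;> omega
  · intro c hc
    obtain ⟨k, rfl⟩ : ∃ k, c = k + 1 := ⟨c - 1, by have := (mem_Icc.1 hc).1; omega⟩
    simp only [hr, hl, add_tsub_cancel_right]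
    have h₁ := hI k
    have h₃ := cnt_succ S k
    have hkW := (mem_Icc.1 hc).2
    split_ifs at * <;> omega

open Classical in
theorem Mtil_row {W : ℕ} {A S : Finset ℕ} (hA : A ⊆ Icc 1 (W + 1)) (hS : S ⊆ Icc 1 W) :
    Mtil (rowReg W A \ dnDents S) ∅ = if Interlace A S then 1 else 0 := by
  unfold Mtil
  split_ifs with h
  · obtain ⟨T, hT⟩ := exists_isTiling_row hA hS h
    rw [card_eq_one]
    refine ⟨T, eq_singleton_iff_unique_mem.2 ⟨mem_tilings.2 ⟨hT, by simp⟩, fun T' hT' => ?_⟩⟩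
    have hT' := (mem_tilings.1 hT').1
    have key : ∀ {T₁ T₂ : Finset Loz}, IsTiling (rowReg W A \ dnDents S) T₁ →
        IsTiling (rowReg W A \ dnDents S) T₂ → T₁ ⊆ T₂ := by
      intro T₁ T₂ h₁ h₂ l hl
      obtain ⟨c, hc, e⟩ := (isTiling_row_iff.1 h₁).1 l hl
      obtain ⟨k, rfl⟩ : ∃ k, c = k + 1 := ⟨c - 1, by have := (mem_Icc.1 hc).1; omega⟩
      have hk : k < W := (mem_Icc.1 hc).2
      have a₁ := (h₁.row hA hS).2 k hk
      have a₂ := (h₂.row hA hS).2 k hk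
      rcases e with rfl | rfl
      · exact a₂.1.2 (a₁.1.1 hl)
      · exact a₂.2.2 (a₁.2.1 hl)
    exact (key hT' hT).antisymm (key hT hT')
  · rw [card_eq_zero, eq_empty_iff_forall_notMem]
    exact fun T hT => h ((mem_tilings.1 hT).1.row hA hS).1

theorem lt_cnt_image_iff {k : ℕ} {a : Fin k → ℕ} (ha : StrictMono a) (i : Fin k) (c : ℕ) :
    (i : ℕ) < cnt (univ.image a) c ↔ a i ≤ c := by
  have e : cnt (univ.image a) c = (univ.filter fun j => a j ≤ c).card := by
    unfold cnt
    rw [filter_image, card_image_of_injective _ ha.injective]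
  rw [e]
  constructor
  · intro h
    by_contra hc
    have : (univ.filter fun j => a j ≤ c) ⊆ Iio i := fun j hj => by
      rw [mem_Iio]
      by_contra hij
      have := ha.monotone (not_lt.1 hij)
      have := (mem_filter.1 hj).2
      omega
    have := card_le_card this
    rw [Fin.card_Iio] at this
    omega
  · intro h
    have : Iic i ⊆ univ.filter fun j => a j ≤ c := fun j hj =>
      mem_filter.2 ⟨mem_univ _, (ha.monotone (mem_Iic.1 hj)).trans h⟩
    have := card_le_card this
    rw [Fin.card_Iic] at this
    omega

theorem cnt_le_card (A : Finset ℕ) (c : ℕ) : cnt A c ≤ A.card := card_filter_le _ _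

theorem interlace_image_iff {k : ℕ} {a : Fin (k + 1) → ℕ} {s : Fin k → ℕ} (ha : StrictMono a)
    (hs : StrictMono s) (ha1 : ∀ i, 1 ≤ a i) (hs1 : ∀ i, 1 ≤ s i) :
    Interlace (univ.image a) (univ.image s) ↔ ∀ i, a i.castSucc ≤ s i ∧ s i < a i.succ := by
  have ca : (univ.image a).card = k + 1 := by simp [card_image_of_injective _ ha.injective]
  have cs : (univ.image s).card = k := by simp [card_image_of_injective _ hs.injective]
  have la := lt_cnt_image_iff ha
  have ls := lt_cnt_image_iff hs
  constructor
  · rintro ⟨-, h⟩ i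
    constructor
    · have h₁ := (h (s i - 1)).1
      rw [Nat.sub_add_cancel (hs1 i)] at h₁
      have h₂ := (ls i (s i)).2 le_rfl
      exact (la i.castSucc (s i)).1 (h₂.trans_le h₁)
    · have h₁ := (h (a i.succ - 1)).2
      rw [Nat.sub_add_cancel (ha1 _)] at h₁
      have h₂ := (la i.succ _).2 le_rfl
      rw [Fin.val_succ] at h₂
      have := (ls i (a i.succ - 1)).1 (by omega)
      have := ha1 i.succ
      omega
  · intro h
    refine ⟨by rw [ca, cs], fun c => ⟨?_, ?_⟩⟩
    · by_contra hlt
      rw [not_le] at hlt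
      have hk : cnt (univ.image a) (c + 1) < k := hlt.trans_le ((cnt_le_card _ _).trans_eq cs)
      have h₁ := (ls ⟨_, hk⟩ _).1 hlt
      exact lt_irrefl _ ((la (Fin.castSucc ⟨_, hk⟩) _).2 ((h ⟨_, hk⟩).1.trans h₁))
    · by_contra hlt
      rw [not_le] at hlt
      have hk : cnt (univ.image s) c < k := by
        have := cnt_le_card (univ.image a) (c + 1)
        omega
      have h₁ := (la (Fin.succ ⟨_, hk⟩) _).1 hlt
      have h₂ := (h ⟨_, hk⟩).2
      exact lt_irrefl _ ((ls ⟨_, hk⟩ c).2 (by omega))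

/-- The determinant of the matrix of binomial coefficients `(v i).choose j`. -/
def chooseDet {k : ℕ} (v : Fin k → ℕ) : ℚ :=
  (Matrix.of fun i j : Fin k => ((v i).choose j : ℚ)).det

theorem sum_Ico_choose_eq {m n : ℕ} (h : m ≤ n) (j : ℕ) :
    ∑ s ∈ Ico m n, (s.choose j : ℚ) = n.choose (j + 1) - m.choose (j + 1) := by
  rw [← sum_Ico_sub (fun s => (s.choose (j + 1) : ℚ)) h]
  refine sum_congr rfl fun s _ => ?_
  rw [Nat.choose_succ_succ]
  push_cast
  ring

theorem sum_chooseDet {k : ℕ} {a : Fin (k + 1) → ℕ} (ha : Monotone a) :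
    ∑ s ∈ Fintype.piFinset fun i : Fin k => Ico (a i.castSucc) (a i.succ), chooseDet s =
      chooseDet a := by
  have e : chooseDet a = (Matrix.of fun i j : Fin (k + 1) =>
      Fin.cases ((a 0).choose j : ℚ)
        (fun i => ((a i.succ).choose j : ℚ) - (a i.castSucc).choose j) i).det :=
    Matrix.det_eq_of_forall_row_eq_smul_add_pred (fun _ => 1) (fun j => by simp)
      (fun i j => by simp)
  rw [e, Matrix.det_succ_column_zero, Fin.sum_univ_succ]
  simp only [Matrix.of_apply, Fin.val_zero, Fin.cases_zero, Fin.cases_succ, Nat.choose_zero_right,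
    sub_self, mul_zero, zero_mul, sum_const_zero, add_zero, pow_zero, Nat.cast_one, one_mul]
  have := (Matrix.detRowAlternating (n := Fin k) (R := ℚ)).toMultilinearMap.map_sum_finset
    (fun _ (s : ℕ) => fun j : Fin k => (s.choose j : ℚ))
    (fun i : Fin k => Ico (a i.castSucc) (a i.succ))
  refine Eq.trans this.symm (congrArg Matrix.det ?_)
  ext i j
  rw [Finset.sum_apply, sum_Ico_choose_eq (ha (Fin.castSucc_lt_succ).le)]
  simp

theorem chooseDet_mul_sfQ {k : ℕ} (v : Fin k → ℕ) :
    sfQ k * chooseDet v = ∏ i, ∏ j ∈ Ioi i, ((v j : ℚ) - v i) := by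
  have h := Matrix.det_eval_matrixOfPolynomials_eq_det_vandermonde (fun i => (v i : ℚ))
    (fun j : Fin k => descPochhammer ℚ j) (fun j => descPochhammer_natDegree ℚ j)
    (fun j => monic_descPochhammer ℚ j)
  rw [Matrix.det_vandermonde] at h
  rw [h, chooseDet, sfQ, ← Fin.prod_univ_eq_prod_range (fun j => (j.factorial : ℚ)),
    ← Matrix.det_mul_row]
  congr 1
  ext i j
  simp only [Matrix.of_apply]
  rw [descPochhammer_eval_eq_descFactorial, Nat.descFactorial_eq_factorial_mul_choose]
  push_cast
  rfl

theorem prodDiff_image {k : ℕ} {a : Fin k → ℕ} (ha : StrictMono a) :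
    prodDiff (univ.image a) = ∏ i, ∏ j ∈ Ioi i, ((a j : ℚ) - a i) := by
  unfold prodDiff
  rw [prod_image ha.injective.injOn]
  refine prod_congr rfl fun i _ => ?_
  rw [filter_image, prod_image ha.injective.injOn]
  refine prod_congr ?_ fun _ _ => rfl
  ext j
  simp [ha.lt_iff_lt]

theorem sfQ_pos (k : ℕ) : 0 < sfQ k :=
  prod_pos fun j _ => by exact_mod_cast j.factorial_pos

theorem chooseDet_eq {k : ℕ} {a : Fin k → ℕ} (ha : StrictMono a) :
    chooseDet a = prodDiff (univ.image a) / sfQ k := by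
  rw [eq_div_iff (sfQ_pos k).ne', prodDiff_image ha, ← chooseDet_mul_sfQ, mul_comm]

theorem eq_image_orderEmbOfFin {A : Finset ℕ} {k : ℕ} (h : A.card = k) :
    ∃ a : Fin k → ℕ, StrictMono a ∧ A = univ.image a :=
  ⟨A.orderEmbOfFin h, (A.orderEmbOfFin h).strictMono, (image_orderEmbOfFin_univ A h).symm⟩

open Classical in
/-- The branching rule for the Vandermonde products. -/
theorem sum_interlace {W k : ℕ} {A : Finset ℕ} (hA : A ⊆ Icc 1 (W + 1)) (hk : A.card = k + 1) :
    ∑ S ∈ (Icc 1 W).powerset.filter (Interlace A), prodDiff S / sfQ k =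
      prodDiff A / sfQ (k + 1) := by
  obtain ⟨a, ha, rfl⟩ := eq_image_orderEmbOfFin hk
  have haW : ∀ i, 1 ≤ a i ∧ a i ≤ W + 1 := fun i =>
    mem_Icc.1 (hA (mem_image_of_mem _ (mem_univ i)))
  have mono : ∀ s ∈ Fintype.piFinset fun i : Fin k => Ico (a i.castSucc) (a i.succ),
      StrictMono s := by
    intro s hs i j hij
    have h₁ := (mem_Ico.1 (Fintype.mem_piFinset.1 hs i)).2
    have h₂ := (mem_Ico.1 (Fintype.mem_piFinset.1 hs j)).1
    have : a i.succ ≤ a j.castSucc := ha.monotone (Fin.succ_le_castSucc_iff.2 hij)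
    omega
  rw [← chooseDet_eq ha, ← sum_chooseDet ha.monotone]
  symm
  refine sum_bij (fun s _ => univ.image s) ?_ ?_ ?_ ?_
  · intro s hs
    have hI := fun i => mem_Ico.1 (Fintype.mem_piFinset.1 hs i)
    have h1 : ∀ i, 1 ≤ s i := fun i => (haW _).1.trans (hI i).1
    refine mem_filter.2 ⟨mem_powerset.2 fun x hx => ?_,
      (interlace_image_iff ha (mono s hs) (fun i => (haW i).1) h1).2 hI⟩
    obtain ⟨i, -, rfl⟩ := mem_image.1 hx
    have := (haW i.succ).2
    have := (hI i).2
    exact mem_Icc.2 ⟨h1 i, by omega⟩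
  · intro s hs t ht h
    rw [← (mono s hs).range_inj (mono t ht)]
    simpa using congrArg (fun S : Finset ℕ => (S : Set ℕ)) h
  · intro S hS
    obtain ⟨hS, hI⟩ := mem_filter.1 hS
    have hSk : S.card = k := by
      have := hI.1
      omega
    obtain ⟨s, hs, rfl⟩ := eq_image_orderEmbOfFin hSk
    have h1 : ∀ i, 1 ≤ s i := fun i =>
      (mem_Icc.1 (mem_powerset.1 hS (mem_image_of_mem _ (mem_univ i)))).1
    refine ⟨s, Fintype.mem_piFinset.2 fun i => mem_Ico.2 ?_, rfl⟩
    exact (interlace_image_iff ha hs (fun i => (haW i).1) h1).1 hI i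
  · intro s hs
    rw [chooseDet_eq (mono s hs)]

theorem mem_image_equiv {α β : Type*} [DecidableEq β] {s : Finset α} (e : α ≃ β) {t : β} :
    t ∈ s.image e ↔ e.symm t ∈ s := by
  simp [← Equiv.eq_symm_apply]

theorem mem_upperHex {W h : ℕ} {b : Bool} {a j : ℤ} :
    (b, a, j) ∈ upperHex W h ↔ 0 ≤ a ∧ 0 ≤ j ∧ j < h ∧ a + j + (if b then 0 else 1) < W := by
  simp only [upperHex, mem_biUnion, mem_union, mem_image, mem_range, upT, dnT, Prod.mk.injEq]
  constructor
  · rintro ⟨j, hj, ⟨a, ha, rfl, rfl, rfl⟩ | ⟨a, ha, rfl, rfl, rfl⟩⟩ <;> simp <;> omega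
  · rintro ⟨h₁, h₂, h₃, h₄⟩
    lift a to ℕ using h₁
    lift j to ℕ using h₂
    refine ⟨j, by omega, ?_⟩
    cases b
    · exact Or.inr ⟨a, by simp at h₄; omega, rfl, rfl, rfl⟩
    · exact Or.inl ⟨a, by simp at h₄; omega, rfl, rfl, rfl⟩

theorem mem_upDents_mk {A : Finset ℕ} {b : Bool} {a j : ℤ} :
    (b, a, j) ∈ upDents A ↔ b = true ∧ j = 0 ∧ ∃ i ∈ A, (i : ℤ) - 1 = a := by
  simp only [upDents, mem_image, upT, Prod.mk.injEq]
  grind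

theorem mem_rowReg {W : ℕ} {A : Finset ℕ} {b : Bool} {a j : ℤ} :
    (b, a, j) ∈ rowReg W A ↔ j = -1 ∧ 0 ≤ a ∧ a + (if b then 0 else 1) ≤ W ∧
      (b = true → ¬ ∃ i ∈ A, (i : ℤ) - 1 = a) := by
  simp only [rowReg, mem_union, mem_image, mem_sdiff, mem_Icc, upT, dnT, Prod.mk.injEq]
  constructor
  · rintro (⟨i, ⟨hi, hA⟩, rfl, rfl, rfl⟩ | ⟨i, hi, rfl, rfl, rfl⟩)
    · refine ⟨rfl, by omega, by simp; omega, ?_⟩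
      rintro - ⟨k, hk, hki⟩
      exact hA (by rwa [show i = k by omega])
    · exact ⟨rfl, by omega, by simp; omega, by simp⟩
  · rintro ⟨rfl, h₁, h₂, h₃⟩
    cases b
    · simp only [Bool.false_eq_true, if_false] at h₂
      exact Or.inr ⟨(a + 1).toNat, by omega, rfl, by omega, rfl⟩
    · simp only [if_true] at h₂
      refine Or.inl ⟨(a + 1).toNat, ⟨by omega, fun h => h₃ rfl ⟨_, h, by omega⟩⟩,
        rfl, by omega, rfl⟩

theorem upperHex_succ_sdiff (W h : ℕ) (A : Finset ℕ) :
    upperHex (W + 1) (h + 1) \ upDents A = (upperHex W h ∪ rowReg W A).image shiftTri := by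
  ext ⟨b, a, j⟩
  rw [mem_image_equiv, mem_sdiff, mem_union]
  simp only [shiftTri, Equiv.coe_fn_symm_mk, mem_upperHex, mem_upDents_mk, mem_rowReg]
  cases b <;> simp <;> grind

/-- The positions on the base of the semihexagon `upperHex W h`. -/
def basePos (W h : ℕ) : Finset ℕ := if h = 0 then ∅ else Icc 1 W

theorem basePos_subset (W h : ℕ) : basePos W h ⊆ Icc 1 W := by
  unfold basePos
  split_ifs <;> simp

theorem upT_mem_upperHex {W h : ℕ} {i : ℤ} :
    upT i 0 ∈ upperHex W h ↔ ∃ c ∈ basePos W h, (c : ℤ) - 1 = i := by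
  unfold upT basePos
  rw [mem_upperHex, if_pos rfl]
  split_ifs with h0
  · simp [h0]
  · simp only [mem_Icc]
    constructor
    · rintro ⟨h₁, -, -, h₂⟩
      exact ⟨(i + 1).toNat, by omega, by omega⟩
    · rintro ⟨c, hc, rfl⟩
      omega

/-- The Cohn-Larsen-Propp formula for dented semihexagons. -/
theorem Mtil_semihexagon {W h : ℕ} (hW : h ≤ W) {A : Finset ℕ} (hA : A ⊆ basePos W h) :
    (Mtil (upperHex W h \ upDents A) ∅ : ℚ) = if A.card = h then prodDiff A / sfQ h else 0 := by
  classical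
  induction h generalizing W A with
  | zero =>
    have hA0 : A = ∅ := by simpa [basePos] using hA
    have hR : upperHex W 0 \ upDents A = ∅ := by simp [upperHex]
    have : tilings ∅ ∅ = {∅} := by
      ext T
      simp only [mem_tilings, mem_singleton, notMem_empty, not_false_eq_true, implies_true,
        and_true, isTiling_iff, false_imp_iff]
      constructor
      · intro h
        refine eq_empty_iff_forall_notMem.2 fun l hl => (h l hl).2 _ (covers_fst l)
      · rintro rfl
        simp
    rw [hR, hA0, Mtil, this]
    simp [prodDiff, sfQ]
  | succ h ih =>
    obtain ⟨W, rfl⟩ : ∃ W', W = W' + 1 := ⟨W - 1, by omega⟩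
    have hA : A ⊆ Icc 1 (W + 1) := hA.trans (basePos_subset _ _)
    rw [upperHex_succ_sdiff, Mtil_image_shiftTri, ← show barrierLoz ∅ = ∅ from rfl,
      Mtil_union (C := basePos W h) ∅ ?_ ?_ ?_]
    · push_cast
      rw [sdiff_empty]
      have step : ∀ S ∈ (basePos W h).powerset,
          (Mtil (upperHex W h \ upDents S) ∅ : ℚ) * Mtil (rowReg W A \ dnDents S) ∅ =
          if Interlace A S then (if A.card = h + 1 then prodDiff S / sfQ h else 0) else 0 := by
        intro S hS
        rw [mem_powerset] at hS
        rw [ih (by omega) hS, Mtil_row hA (hS.trans (basePos_subset _ _))]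
        by_cases hI : Interlace A S
        · have : S.card = h ↔ A.card = h + 1 := by
            have := hI.1
            omega
          simp [hI, this]
        · simp [hI]
      rw [sum_congr rfl step, ← sum_filter]
      split_ifs with hc
      · rw [← sum_interlace hA hc]
        refine sum_congr ?_ fun _ _ => rfl
        ext S
        simp only [mem_filter, mem_powerset, and_congr_left_iff]
        intro hI
        refine ⟨fun h => h.trans (basePos_subset _ _), fun hS => ?_⟩
        unfold basePos
        split_ifs with h0
        · have := hI.1
          have : S = ∅ := card_eq_zero.1 (by omega)
          simp [this]
        · exact hS
      · simp
    · rintro ⟨b, a, j⟩ ht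
      exact (mem_upperHex.1 ht).2.1
    · rintro ⟨b, a, j⟩ ht
      simp [(mem_rowReg.1 ht).1]
    · intro i
      rw [upT_mem_upperHex, and_iff_left_iff_imp]
      rintro ⟨c, hc, rfl⟩
      have := mem_Icc.1 (basePos_subset _ _ hc)
      unfold dnT
      rw [mem_rowReg]
      simp
      omega

theorem dnDents_eq_image (D : Finset ℕ) : dnDents D = (upDents D).image reflTri := by
  unfold dnDents upDents
  rw [image_image]
  refine image_congr fun i _ => ?_
  simp [reflTri, upT, dnT]

theorem upDents_union (A S : Finset ℕ) : upDents (A ∪ S) = upDents A ∪ upDents S :=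
  image_union _ _

theorem image_reflTri_sdiff (R : Finset Tri) (D : Finset ℕ) :
    R.image reflTri \ dnDents D = (R \ upDents D).image reflTri := by
  rw [dnDents_eq_image, image_sdiff _ _ reflTri_involutive.injective]

theorem dnT_mem_image_reflTri {R : Finset Tri} {i : ℤ} :
    dnT i (-1) ∈ R.image reflTri ↔ upT i 0 ∈ R := by
  have : dnT i (-1) = reflTri (upT i 0) := by simp [reflTri, upT, dnT]
  rw [this, reflTri_involutive.injective.mem_finset_image]

theorem upT_mem_upDents {A : Finset ℕ} {c : ℕ} : upT ((c : ℤ) - 1) 0 ∈ upDents A ↔ c ∈ A := by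
  unfold upT
  rw [mem_upDents_mk]
  simp

theorem Mtil_Hreg {x y n : ℕ} {U D B : Finset ℕ} (hu : U.card ≤ n) (hd : D.card ≤ n)
    (hU : U ⊆ Icc 1 (x + y + n)) (hD : D ⊆ Icc 1 (x + y + n)) :
    (Mtil (Hreg x y n U D) (barrierLoz B) : ℚ) =
      ∑ S ∈ powersetCard y ((Icc 1 (x + y + n) \ (U ∪ D)) \ B),
        prodDiff (U ∪ S) / sfQ (y + U.card) * (prodDiff (D ∪ S) / sfQ (y + D.card)) := by
  set W := x + y + n with hWdef
  set C := (basePos W (y + U.card) ∩ basePos W (y + D.card)) \ (U ∪ D) with hCdef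
  have hUb : U ⊆ basePos W (y + U.card) := by
    unfold basePos
    split_ifs with h
    · rw [card_eq_zero.1 (Nat.add_eq_zero_iff.1 h).2]
    · exact hU
  have hDb : D ⊆ basePos W (y + D.card) := by
    unfold basePos
    split_ifs with h
    · rw [card_eq_zero.1 (Nat.add_eq_zero_iff.1 h).2]
    · exact hD
  unfold Hreg
  rw [Mtil_union (C := C) B ?_ ?_ ?_]
  · push_cast
    have step : ∀ S ∈ (C \ B).powerset,
        (Mtil ((upperHex W (y + U.card) \ upDents U) \ upDents S) ∅ : ℚ) *
          Mtil (((upperHex W (y + D.card)).image reflTri \ dnDents D) \ dnDents S) ∅ =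
        if S.card = y then
          prodDiff (U ∪ S) / sfQ (y + U.card) * (prodDiff (D ∪ S) / sfQ (y + D.card)) else 0 := by
      intro S hS
      have hSC : S ⊆ C := (mem_powerset.1 hS).trans sdiff_subset
      obtain ⟨hSb, hSd⟩ := subset_sdiff.1 hSC
      obtain ⟨hSU, hSD⟩ := subset_inter_iff.1 hSb
      obtain ⟨dU, dD⟩ := disjoint_union_right.1 hSd
      have cU : (U ∪ S).card = y + U.card ↔ S.card = y := by
        rw [card_union_of_disjoint dU.symm]
        omega
      have cD : (D ∪ S).card = y + D.card ↔ S.card = y := by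
        rw [card_union_of_disjoint dD.symm]
        omega
      rw [image_reflTri_sdiff, image_reflTri_sdiff, Mtil_image_reflTri, sdiff_sdiff_left,
        sdiff_sdiff_left, sup_eq_union, sup_eq_union, ← upDents_union, ← upDents_union,
        Mtil_semihexagon (by omega) (union_subset hUb hSU),
        Mtil_semihexagon (by omega) (union_subset hDb hSD)]
      simp only [cU, cD]
      split_ifs <;> simp
    rw [sum_congr rfl step, ← sum_filter, ← powersetCard_eq_filter]
    refine sum_congr ?_ fun _ _ => rfl
    rcases Nat.eq_zero_or_pos y with rfl | hy
    · simp
    · simp only [hCdef, basePos]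
      rw [if_neg (by omega), if_neg (by omega), inter_self]
  · rintro ⟨b, a, j⟩ ht
    exact (mem_upperHex.1 (mem_sdiff.1 ht).1).2.1
  · intro t ht
    obtain ⟨⟨b, a, j⟩, hm, rfl⟩ := mem_image.1 (mem_sdiff.1 ht).1
    have := (mem_upperHex.1 hm).2.1
    cases b <;> simp [reflTri] <;> omega
  · intro i
    rw [image_reflTri_sdiff, dnT_mem_image_reflTri, mem_sdiff, mem_sdiff, upT_mem_upperHex,
      upT_mem_upperHex]
    constructor
    · rintro ⟨⟨⟨c, hc, rfl⟩, hcU⟩, ⟨c', hc', e⟩, hcD⟩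
      obtain rfl : c' = c := by omega
      rw [upT_mem_upDents] at hcU hcD
      exact ⟨c', by simp [*], rfl⟩
    · rintro ⟨c, hc, rfl⟩
      simp only [hCdef, mem_sdiff, mem_inter, mem_union, not_or] at hc
      rw [upT_mem_upDents, upT_mem_upDents]
      exact ⟨⟨⟨c, hc.1.1, rfl⟩, hc.2.1⟩, ⟨c, hc.1.2, rfl⟩, hc.2.2⟩

theorem prodDiff_pos (S : Finset ℕ) : 0 < prodDiff S :=
  prod_pos fun p _ => prod_pos fun q hq => by
    have := (mem_filter.1 hq).2
    rw [sub_pos]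
    exact_mod_cast this

theorem prodDiff_union {A S : Finset ℕ} (h : Disjoint A S) :
    prodDiff (A ∪ S) = prodDiff A * prodDiff S * ∏ a ∈ A, ∏ s ∈ S, |(s : ℚ) - a| := by
  have key : (∏ a ∈ A, ∏ s ∈ S with a < s, ((s : ℚ) - a)) *
      ∏ s ∈ S, ∏ a ∈ A with s < a, ((a : ℚ) - s) = ∏ a ∈ A, ∏ s ∈ S, |(s : ℚ) - a| := by
    simp only [prod_filter]
    rw [prod_comm (s := S), ← prod_mul_distrib]
    refine prod_congr rfl fun a ha => ?_
    rw [← prod_mul_distrib]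
    refine prod_congr rfl fun s hs => ?_
    rcases lt_or_gt_of_ne (disjoint_iff_ne.1 h a ha s hs) with hlt | hlt
    · have : (a : ℚ) < s := by exact_mod_cast hlt
      rw [if_pos hlt, if_neg hlt.asymm, mul_one, abs_of_pos (sub_pos.2 this)]
    · have : (s : ℚ) < a := by exact_mod_cast hlt
      rw [if_neg hlt.asymm, if_pos hlt, one_mul, abs_sub_comm, abs_of_pos (sub_pos.2 this)]
  have split : ∀ p : ℕ, ∏ q ∈ A ∪ S with p < q, ((q : ℚ) - p) =
      (∏ q ∈ A with p < q, ((q : ℚ) - p)) * ∏ q ∈ S with p < q, ((q : ℚ) - p) := fun p => by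
    rw [filter_union, prod_union (disjoint_filter_filter h)]
  unfold prodDiff
  simp only [split]
  rw [prod_union h, prod_mul_distrib, prod_mul_distrib, ← key]
  ring

theorem sfQ_succ (k : ℕ) : sfQ (k + 1) = sfQ k * k.factorial := prod_range_succ _ _

theorem prod_add_two_div_add_one (m b : ℕ) :
    ∏ j ∈ range b, ((m : ℚ) + j + 2) / (m + j + 1) = (m + b + 1) / (m + 1) := by
  induction b with
  | zero =>
    have : (m : ℚ) + 1 ≠ 0 := by positivity
    simp [this]
  | succ b ih =>
    rw [prod_range_succ, ih]
    push_cast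
    have : (m : ℚ) + 1 ≠ 0 := by positivity
    have : (m : ℚ) + b + 1 ≠ 0 := by positivity
    field_simp
    ring

theorem prod_prod_add_two_div_add_one (a b c : ℕ) :
    (∏ j ∈ range b, ∏ k ∈ range c, ((a : ℚ) + j + k + 2) / (a + j + k + 1)) *
      ((a + b).factorial * (c + a).factorial) = a.factorial * (c + a + b).factorial := by
  induction c with
  | zero => simp [mul_comm]
  | succ c ih =>
    simp only [prod_range_succ, prod_mul_distrib]
    have h := prod_add_two_div_add_one (a + c) b
    have e : ∏ j ∈ range b, ((a : ℚ) + j + c + 2) / (a + j + c + 1) =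
        (a + c + b + 1) / (a + c + 1) := by
      push_cast at h
      rw [← h]
      refine prod_congr rfl fun j _ => ?_
      congr 1 <;> ring
    have e1 : c + 1 + a = c + a + 1 := by ring
    have e2 : c + a + 1 + b = c + a + b + 1 := by ring
    rw [e, e1, e2, Nat.factorial_succ, Nat.factorial_succ]
    push_cast
    have : (a : ℚ) + c + 1 ≠ 0 := by positivity
    field_simp
    linear_combination ((a : ℚ) + c + b + 1) * (a + c + 1) * ih

/-- MacMahon's formula in terms of superfactorials. -/
theorem PP_eq (a b c : ℕ) :
    PP a b c * (sfQ (a + b) * sfQ (c + a) * sfQ (c + b)) =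
      sfQ a * sfQ b * (sfQ c * sfQ (c + a + b)) := by
  induction a with
  | zero => simp [PP, sfQ]; ring
  | succ a ih =>
    have hP : PP (a + 1) b c * ((a + b).factorial * (c + a).factorial : ℚ) =
        PP a b c * (a.factorial * (c + a + b).factorial) := by
      have h := prod_prod_add_two_div_add_one a b c
      have : PP (a + 1) b c = PP a b c *
          ∏ j ∈ range b, ∏ k ∈ range c, ((a : ℚ) + j + k + 2) / (a + j + k + 1) :=
        prod_range_succ _ _
      rw [this, mul_assoc, h]
    have e : a + 1 + b = a + b + 1 := by ring
    have e' : c + (a + 1) = c + a + 1 := by ring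
    have e'' : c + a + 1 + b = c + a + b + 1 := by ring
    rw [e', e, e'', sfQ_succ, sfQ_succ, sfQ_succ, sfQ_succ]
    linear_combination (sfQ (a + b) * sfQ (c + a) * sfQ (c + b)) * hP +
      ((a.factorial : ℚ) * (c + a + b).factorial) * ih

theorem PP_pos (a b c : ℕ) : 0 < PP a b c :=
  prod_pos fun _ _ => prod_pos fun _ _ => prod_pos fun _ _ => by positivity

/-- The summand of the tiling count left after pulling out the product over `U` and `D`. -/
def dentWeight (U D S : Finset ℕ) : ℚ :=
  prodDiff S ^ 2 *
    ((∏ a ∈ U, ∏ s ∈ S, |(s : ℚ) - a|) * ∏ a ∈ D, ∏ s ∈ S, |(s : ℚ) - a|)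

theorem dentWeight_congr {U D U' D' : Finset ℕ} (hcup : U ∪ D = U' ∪ D')
    (hcap : U ∩ D = U' ∩ D') (S : Finset ℕ) : dentWeight U D S = dentWeight U' D' S := by
  unfold dentWeight
  rw [← prod_union_inter, hcup, hcap, prod_union_inter]

theorem dentWeight_pos {U D S : Finset ℕ} (h : Disjoint (U ∪ D) S) : 0 < dentWeight U D S := by
  have key : ∀ A ⊆ U ∪ D, 0 < ∏ a ∈ A, ∏ s ∈ S, |(s : ℚ) - a| := fun A hA =>
    prod_pos fun a ha => prod_pos fun s hs => by
      have := disjoint_iff_ne.1 h a (hA ha) s hs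
      rw [abs_pos, sub_ne_zero]
      exact_mod_cast this.symm
  exact mul_pos (pow_pos (prodDiff_pos S) 2)
    (mul_pos (key U subset_union_left) (key D subset_union_right))

theorem disjoint_of_mem_powersetCard {y : ℕ} {I A B S : Finset ℕ}
    (hS : S ∈ powersetCard y ((I \ A) \ B)) : Disjoint A S :=
  disjoint_of_subset_right ((mem_powersetCard.1 hS).1.trans sdiff_subset) disjoint_sdiff

theorem Mtil_Hreg_eq_mul_sum {x y n : ℕ} {U D B : Finset ℕ} (hu : U.card ≤ n) (hd : D.card ≤ n)
    (hU : U ⊆ Icc 1 (x + y + n)) (hD : D ⊆ Icc 1 (x + y + n)) :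
    (Mtil (Hreg x y n U D) (barrierLoz B) : ℚ) =
      prodDiff U * prodDiff D / (sfQ (y + U.card) * sfQ (y + D.card)) *
        ∑ S ∈ powersetCard y ((Icc 1 (x + y + n) \ (U ∪ D)) \ B), dentWeight U D S := by
  rw [Mtil_Hreg hu hd hU hD, mul_sum]
  refine sum_congr rfl fun S hS => ?_
  have h := disjoint_union_left.1 (disjoint_of_mem_powersetCard hS)
  rw [prodDiff_union h.1, prodDiff_union h.2, dentWeight]
  ring

theorem sum_dentWeight_pos {x y n : ℕ} {U D B : Finset ℕ} (hn : (U ∪ D).card = n)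
    (hB : B.card ≤ x) :
    0 < ∑ S ∈ powersetCard y ((Icc 1 (x + y + n) \ (U ∪ D)) \ B), dentWeight U D S := by
  refine sum_pos (fun S hS => dentWeight_pos (disjoint_of_mem_powersetCard hS)) ?_
  rw [powersetCard_nonempty]
  have h₁ := le_card_sdiff (U ∪ D) (Icc 1 (x + y + n))
  have h₂ := le_card_sdiff B (Icc 1 (x + y + n) \ (U ∪ D))
  rw [Nat.card_Icc] at h₁
  omega

/-- **Shuffling Theorem for doubly-dented hexagons** (Theorem 1.2). -/
theorem shuffling_doubly_dented_hexagons
    (x y u d u' d' n : ℕ) (hu : u ≤ n) (hd : d ≤ n) (hu' : u' ≤ n) (hd' : d' ≤ n)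
    (U D U' D' B : Finset ℕ)
    (hUc : U.card = u) (hDc : D.card = d) (hU'c : U'.card = u') (hD'c : D'.card = d')
    (hUsub : U ⊆ Finset.Icc 1 (x + y + n)) (hDsub : D ⊆ Finset.Icc 1 (x + y + n))
    (hU'sub : U' ⊆ Finset.Icc 1 (x + y + n)) (hD'sub : D' ⊆ Finset.Icc 1 (x + y + n))
    (hn : (U ∪ D).card = n)
    (hcup : U ∪ D = U' ∪ D') (hcap : U ∩ D = U' ∩ D')
    (hBsub : B ⊆ Finset.Icc 1 (x + y + n) \ (U ∪ D)) (hBc : B.card ≤ x) :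
    (Mtil (Hreg x y n U D) (barrierLoz B) : ℚ) /
      (Mtil (Hreg x y n U' D') (barrierLoz B) : ℚ) =
    (prodDiff U / sfQ u * (prodDiff D / sfQ d) * PP u d y) /
      (prodDiff U' / sfQ u' * (prodDiff D' / sfQ d') * PP u' d' y) := by
  subst hUc hDc hU'c hD'c
  have hc : U.card + D.card = U'.card + D'.card := by
    rw [← card_union_add_card_inter, hcup, hcap, card_union_add_card_inter]
  rw [Mtil_Hreg_eq_mul_sum hu hd hUsub hDsub, Mtil_Hreg_eq_mul_sum hu' hd' hU'sub hD'sub,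
    ← hcup, sum_congr rfl fun S _ => (dentWeight_congr hcup hcap S).symm,
    mul_div_mul_right _ _ (sum_dentWeight_pos hn hBc).ne']
  have hPP := PP_eq U.card D.card y
  have hPP' := PP_eq U'.card D'.card y
  rw [add_assoc] at hPP hPP'
  rw [← hc] at hPP'
  have := (prodDiff_pos U').ne'
  have := (prodDiff_pos D').ne'
  have := (PP_pos U'.card D'.card y).ne'
  have := (sfQ_pos (y + U.card)).ne'
  have := (sfQ_pos (y + D.card)).ne'
  have := (sfQ_pos (y + U'.card)).ne'
  have := (sfQ_pos (y + D'.card)).ne'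
  have := (sfQ_pos U.card).ne'
  have := (sfQ_pos D.card).ne'
  have := (sfQ_pos U'.card).ne'
  have := (sfQ_pos D'.card).ne'
  have hpos : sfQ y * sfQ (y + (U.card + D.card)) * sfQ (U.card + D.card) ≠ 0 :=
    (mul_pos (mul_pos (sfQ_pos _) (sfQ_pos _)) (sfQ_pos _)).ne'
  have key : PP U'.card D'.card y * sfQ (y + U'.card) * sfQ (y + D'.card) *
        (sfQ U.card * sfQ D.card) =
      PP U.card D.card y * sfQ (y + U.card) * sfQ (y + D.card) *
        (sfQ U'.card * sfQ D'.card) := by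
    refine mul_right_cancel₀ hpos ?_
    linear_combination (sfQ y * sfQ (y + (U.card + D.card))) * (sfQ U.card * sfQ D.card) * hPP' -
      (sfQ y * sfQ (y + (U.card + D.card))) * (sfQ U'.card * sfQ D'.card) * hPP
  field_simp
  linear_combination (prodDiff U * prodDiff D) * key
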